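/- Neyman orthogonality of the AIPW score: let b₁ be a propensity score with positivity margin ε ∈ (0, 1/2), let m₀ be an outcome regression with Y and m₀(A, X) integrable, and let m : {0,1} × 𝒳 → ℝ and b : 𝒳 → ℝ be arbitrary bounded measurable functions. Then the Gateaux derivative of the map (m, b) ↦ E[ψ(m, b)] at the true nuisance pair (m₀, b₁) in the direction (m − m₀, b − b₁) vanishes; explicitly, E[m(1,X) − m₀(1,X)] − E[m(0,X) − m₀(0,X)] − E[A·(m(1,X) − m₀(1,X))/b₁(X)] + E[(1−A)·(m(0,X) − m₀(0,X))/(1 − b₁(X))] − E[A·(Y − m₀(1,X))·(b(X) − b₁(X))/b₁(X)²] + E[(1−A)·(Y − m₀(0,X))·(b(X) − b₁(X))/(1 − b₁(X))²] = 0. -/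

import Mathlib

open MeasureTheory ProbabilityTheory

/-- Inverse-probability weighting: if `P` is a nowhere vanishing version of `μ[T | m]`, then weighting
an `m`-measurable function by `T / P` does not change its integral. -/
theorem integral_mul_div_of_ae_eq_condExp {Ω : Type*} {m m₀ : MeasurableSpace Ω} {μ : Measure Ω}
    [IsFiniteMeasure μ] (hm : m ≤ m₀) {T P f : Ω → ℝ} (hT : Integrable T μ)
    (hTP : P =ᵐ[μ] μ[T | m]) (hP0 : ∀ ω, P ω ≠ 0) (hP : StronglyMeasurable[m] P)
    (hf : StronglyMeasurable[m] f) (hint : Integrable (fun ω => T ω * f ω / P ω) μ) :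
    ∫ ω, T ω * f ω / P ω ∂μ = ∫ ω, f ω ∂μ := by
  have heq : (fun ω => T ω * f ω / P ω) = T * (fun ω => f ω / P ω) := by
    ext ω
    simp [mul_div_assoc]
  have hg : StronglyMeasurable[m] (fun ω => f ω / P ω) :=
    (hf.measurable.div hP.measurable).stronglyMeasurable
  have hpull := condExp_mul_of_stronglyMeasurable_right hg (heq ▸ hint) hT
  rw [← integral_condExp hm]
  refine integral_congr_ae ?_
  rw [heq]
  filter_upwards [hpull, hTP] with ω h₁ h₂
  rw [h₁, Pi.mul_apply, ← h₂, mul_div_cancel₀ _ (hP0 ω)]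

/-- The residual `Y - μ[Y | m]` is orthogonal to every bounded `m`-measurable function. -/
theorem integral_mul_sub_condExp_eq_zero {Ω : Type*} {m m₀ : MeasurableSpace Ω} {μ : Measure Ω}
    [IsFiniteMeasure μ] (hm : m ≤ m₀) {Y M g : Ω → ℝ} (hY : Integrable Y μ)
    (hM : M =ᵐ[μ] μ[Y | m]) (hg : StronglyMeasurable[m] g) {C : ℝ} (hC : ∀ ω, |g ω| ≤ C) :
    ∫ ω, g ω * (Y ω - M ω) ∂μ = 0 := by
  have hMint : Integrable M μ := integrable_condExp.congr hM.symm
  have hbdd {Z : Ω → ℝ} (hZ : Integrable Z μ) : Integrable (fun ω => g ω * Z ω) μ :=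
    hZ.bdd_mul (hg.mono hm).aestronglyMeasurable (Filter.Eventually.of_forall hC)
  have hpull := condExp_mul_of_stronglyMeasurable_left hg (hbdd hY) hY
  have hMY : ∫ ω, g ω * M ω ∂μ = ∫ ω, g ω * Y ω ∂μ := by
    rw [← integral_condExp hm (f := fun ω => g ω * Y ω)]
    refine integral_congr_ae ?_
    filter_upwards [hpull, hM] with ω h₁ h₂
    rw [h₂]
    exact h₁.symm
  simp_rw [mul_sub]
  rw [integral_sub (hbdd hY) (hbdd hMint), hMY, sub_self]

section TreatmentArm

variable {Ω 𝒳 : Type*} [MeasurableSpace Ω] [MeasurableSpace 𝒳] {μ : Measure Ω}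
  [IsProbabilityMeasure μ] {X : Ω → 𝒳} {A : Ω → ℝ} {t : ℝ → ℝ} {a ε : ℝ} {p : 𝒳 → ℝ}

/-- If `t ∘ A` is the indicator of `A = a` and `p` is its propensity, bounded away from zero, then
weighting `f a X` by `t A / p X` does not change its integral. -/
theorem integral_arm_weighted_eq (hX : Measurable X) (hA : Measurable A) (ht : Measurable t)
    (htA : ∀ ω, t (A ω) = 0 ∨ t (A ω) = 1 ∧ A ω = a) (hp : Measurable p) (hε : 0 < ε)
    (hεp : ∀ x, ε ≤ p x)
    (hps : (fun ω => p (X ω)) =ᵐ[μ]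
      μ[fun ω => t (A ω) | MeasurableSpace.comap X inferInstance])
    {f : ℝ → 𝒳 → ℝ} (hf : Measurable (f a))
    (hfint : Integrable (fun ω => f (A ω) (X ω)) μ) :
    ∫ ω, t (A ω) * f a (X ω) / p (X ω) ∂μ = ∫ ω, f a (X ω) ∂μ := by
  have hXm : Measurable[MeasurableSpace.comap X inferInstance] X := comap_measurable X
  have htA1 (ω : Ω) : |t (A ω)| ≤ 1 := by
    rcases htA ω with h | ⟨h, -⟩ <;> simp [h]
  have hp0 (x : 𝒳) : 0 < p x := hε.trans_le (hεp x)
  refine integral_mul_div_of_ae_eq_condExp hX.comap_le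
    (Integrable.of_bound (ht.comp hA).aestronglyMeasurable 1 (Filter.Eventually.of_forall htA1))
    hps (fun ω => (hp0 _).ne') (hp.comp hXm).stronglyMeasurable
    (hf.comp hXm).stronglyMeasurable ?_
  have hw : Measurable fun ω => t (A ω) / p (X ω) := (ht.comp hA).div (hp.comp hX)
  refine (hfint.bdd_mul (c := 1 / ε) hw.aestronglyMeasurable
    (Filter.Eventually.of_forall fun ω => ?_)).congr (Filter.Eventually.of_forall fun ω => ?_)
  · rw [Real.norm_eq_abs, abs_div, abs_of_pos (hp0 _)]
    exact div_le_div₀ zero_le_one (htA1 ω) hε (hεp _)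
  · rcases htA ω with h | ⟨-, h⟩
    · simp [h]
    · simp only [h]
      ring

/-- If `t ∘ A` is the indicator of `A = a` and `m₀` is an outcome regression, then the residual
`Y - m₀ a X` on the arm `A = a` is orthogonal to `h X / p X ^ 2` for bounded `h`. -/
theorem integral_arm_residual_eq_zero (hX : Measurable X) (hA : Measurable A) (ht : Measurable t)
    (htA : ∀ ω, t (A ω) = 0 ∨ t (A ω) = 1 ∧ A ω = a) (hp : Measurable p) (hε : 0 < ε)
    (hεp : ∀ x, ε ≤ p x) {Y : Ω → ℝ} (hY : Integrable Y μ) {m₀ : ℝ → 𝒳 → ℝ}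
    (hreg : (fun ω => m₀ (A ω) (X ω)) =ᵐ[μ]
      μ[Y | MeasurableSpace.comap (fun ω => (A ω, X ω)) inferInstance])
    {h : 𝒳 → ℝ} (hh : Measurable h) {C : ℝ} (hC : ∀ x, |h x| ≤ C) :
    ∫ ω, t (A ω) * (Y ω - m₀ a (X ω)) * h (X ω) / p (X ω) ^ 2 ∂μ = 0 := by
  have hAX : Measurable[MeasurableSpace.comap (fun ω => (A ω, X ω)) inferInstance]
      (fun ω => (A ω, X ω)) := comap_measurable _
  have hw : Measurable fun q : ℝ × 𝒳 => t q.1 * h q.2 / p q.2 ^ 2 := by fun_prop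
  have hbound (ω : Ω) : |t (A ω) * h (X ω) / p (X ω) ^ 2| ≤ C / ε ^ 2 := by
    have hC0 : 0 ≤ C := (abs_nonneg _).trans (hC (X ω))
    have hnum : |t (A ω) * h (X ω)| ≤ C := by
      rcases htA ω with h' | ⟨h', -⟩ <;> simp [h', hC0, hC]
    rw [abs_div, abs_of_nonneg (sq_nonneg (p (X ω)))]
    exact div_le_div₀ hC0 hnum (by positivity) (pow_le_pow_left₀ hε.le (hεp _) 2)
  rw [← integral_mul_sub_condExp_eq_zero (hA.prodMk hX).comap_le hY hreg
    (hw.comp hAX).stronglyMeasurable hbound]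
  congr 1 with ω
  rcases htA ω with h' | ⟨-, h'⟩
  · simp [h']
  · simp only [h', Function.comp_apply]
    ring

end TreatmentArm

/-- **Neyman orthogonality of the AIPW score.** At the true nuisance pair `(m₀, b₁)` (outcome
regression and propensity score, with positivity margin `ε ∈ (0,1/2)`), the Gateaux derivative of
`(m, b) ↦ E[ψ(m, b)]` in the direction `(m − m₀, b − b₁)` vanishes, for arbitrary bounded
measurable `m` and `b`. -/
theorem aipw_neyman_orthogonality
    {Ω 𝒳 : Type*} [MeasurableSpace Ω] [MeasurableSpace 𝒳]
    (μ : Measure Ω) [IsProbabilityMeasure μ]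
    (X : Ω → 𝒳) (hX : Measurable X)
    (A : Ω → ℝ) (hA : Measurable A) (hA01 : ∀ ω, A ω = 0 ∨ A ω = 1)
    (Y : Ω → ℝ) (hY : Integrable Y μ)
    (b₁ : 𝒳 → ℝ) (hb₁ : Measurable b₁)
    (hps : (fun ω => b₁ (X ω)) =ᵐ[μ] μ[A | MeasurableSpace.comap X inferInstance])
    (ε : ℝ) (hε : ε ∈ Set.Ioo (0 : ℝ) (1/2))
    (hpos : ∀ x, ε ≤ b₁ x ∧ b₁ x ≤ 1 - ε)
    (m₀ : ℝ → 𝒳 → ℝ) (hm₀ : Measurable (fun p : ℝ × 𝒳 => m₀ p.1 p.2))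
    (hreg : (fun ω => m₀ (A ω) (X ω)) =ᵐ[μ]
      μ[Y | MeasurableSpace.comap (fun ω => (A ω, X ω)) inferInstance])
    (hm₀int : Integrable (fun ω => m₀ (A ω) (X ω)) μ)
    (m : ℝ → 𝒳 → ℝ) (hm : Measurable (fun p : ℝ × 𝒳 => m p.1 p.2))
    (hmbdd : ∃ C, ∀ a x, |m a x| ≤ C)
    (b : 𝒳 → ℝ) (hb : Measurable b) (hbbdd : ∃ C, ∀ x, |b x| ≤ C) :
    ∫ ω, (m 1 (X ω) - m₀ 1 (X ω)) ∂μ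
      - ∫ ω, (m 0 (X ω) - m₀ 0 (X ω)) ∂μ
      - ∫ ω, A ω * (m 1 (X ω) - m₀ 1 (X ω)) / b₁ (X ω) ∂μ
      + ∫ ω, (1 - A ω) * (m 0 (X ω) - m₀ 0 (X ω)) / (1 - b₁ (X ω)) ∂μ
      - ∫ ω, A ω * (Y ω - m₀ 1 (X ω)) * (b (X ω) - b₁ (X ω)) / (b₁ (X ω)) ^ 2 ∂μ
      + ∫ ω, (1 - A ω) * (Y ω - m₀ 0 (X ω)) * (b (X ω) - b₁ (X ω)) / (1 - b₁ (X ω)) ^ 2 ∂μ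
      = 0 := by
  obtain ⟨hε0, -⟩ := hε
  obtain ⟨Cm, hCm⟩ := hmbdd
  obtain ⟨Cb, hCb⟩ := hbbdd
  have hAint : Integrable A μ := by
    refine Integrable.of_bound hA.aestronglyMeasurable 1 (Filter.Eventually.of_forall fun ω => ?_)
    rcases hA01 ω with h | h <;> simp [h]
  have hps' : (fun ω => 1 - b₁ (X ω)) =ᵐ[μ]
      μ[fun ω => 1 - A ω | MeasurableSpace.comap X inferInstance] := by
    have hsub := condExp_sub (integrable_const (1 : ℝ)) hAint (MeasurableSpace.comap X inferInstance)
    rw [condExp_const hX.comap_le] at hsub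
    filter_upwards [hsub, hps] with ω h₁ h₂
    rw [h₂]
    exact h₁.symm
  have htreated (ω : Ω) : id (A ω) = 0 ∨ id (A ω) = 1 ∧ A ω = 1 := by
    rcases hA01 ω with h | h <;> simp [h]
  have hcontrol (ω : Ω) : (1 - A ω) = 0 ∨ (1 - A ω) = 1 ∧ A ω = 0 := by
    rcases hA01 ω with h | h <;> simp [h]
  have hp₁ (x : 𝒳) : ε ≤ b₁ x := (hpos x).1
  have hp₀ (x : 𝒳) : ε ≤ 1 - b₁ x := by linarith [(hpos x).2]
  have hb₁' : Measurable fun x => 1 - b₁ x := measurable_const.sub hb₁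
  have ht : Measurable fun y : ℝ => 1 - y := measurable_const.sub measurable_id
  have hdiff (a : ℝ) : Measurable fun x => m a x - m₀ a x :=
    (hm.comp measurable_prodMk_left).sub (hm₀.comp measurable_prodMk_left)
  have hdiffint : Integrable (fun ω => m (A ω) (X ω) - m₀ (A ω) (X ω)) μ :=
    (Integrable.of_bound (hm.comp (hA.prodMk hX)).aestronglyMeasurable Cm
      (Filter.Eventually.of_forall fun ω => hCm _ _)).sub hm₀int
  have hh : Measurable fun x => b x - b₁ x := hb.sub hb₁
  have hhbdd (x : 𝒳) : |b x - b₁ x| ≤ Cb + 1 := by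
    have hb₁abs : |b₁ x| ≤ 1 := abs_le.2 ⟨by linarith [hp₁ x], by linarith [hp₀ x]⟩
    exact (abs_sub _ _).trans (add_le_add (hCb x) hb₁abs)
  have hw₁ := integral_arm_weighted_eq hX hA measurable_id htreated hb₁ hε0 hp₁ hps
    (f := fun a x => m a x - m₀ a x) (hdiff 1) hdiffint
  have hw₀ := integral_arm_weighted_eq hX hA ht hcontrol hb₁' hε0 hp₀ hps'
    (f := fun a x => m a x - m₀ a x) (hdiff 0) hdiffint
  have hr₁ := integral_arm_residual_eq_zero hX hA measurable_id htreated hb₁ hε0 hp₁ hY hreg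
    hh hhbdd
  have hr₀ := integral_arm_residual_eq_zero hX hA ht hcontrol hb₁' hε0 hp₀ hY hreg hh hhbdd
  simp only [id] at hw₁ hr₁
  rw [hw₁, hw₀, hr₁, hr₀]
  ring
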